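/- Let a, b, c, d, x₀, x₁ be nonzero real numbers with a < 0, c < 0, b > 0, d > 0, x₀ > 1 and x₁ > 1. Then the piecewise holomorphic system ż = (a+ib)(z − i + x₁) for z ∈ Σ_+, ż = i/z for z ∈ Σ_c, ż = (c+id)(z + i − x₀) for z ∈ Σ_−, has a crossing limit cycle. -/

import Mathlib

open Complex Set

/-- A *crossing periodic orbit* of the piecewise system `z' = fields σ z` for `z ∈ zones σ`,
where the discontinuity set is the union of the zero sets of the functions in `curves`:
a nonconstant continuous `T`-periodic curve, satisfying the differential equation of each
zone inside that (open) zone, meeting the discontinuity set at only finitely many times per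
period, and crossing it transversally there (at each such point the two one-sided vector
fields have nonzero normal component to the discontinuity curve, of the same sign; the normal
direction is given by the gradient, i.e. the Fréchet derivative, of the defining function of
the curve). -/
def IsCrossingPeriodicOrbit {ι : Type} (zones : ι → Set ℂ) (fields : ι → ℂ → ℂ)
    (curves : Set (ℂ → ℝ)) (z : ℝ → ℂ) : Prop :=
  ∃ T : ℝ, 0 < T ∧
    Continuous z ∧ Function.Periodic z T ∧ (∃ s t : ℝ, z s ≠ z t) ∧
    (∀ (t : ℝ) (σ : ι), z t ∈ zones σ → HasDerivAt z (fields σ (z t)) t) ∧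
    {t ∈ Set.Ico (0:ℝ) T | ∃ g ∈ curves, g (z t) = 0}.Finite ∧
    (∀ t : ℝ, (∃ g ∈ curves, g (z t) = 0) →
      ∃ σ₁ σ₂ : ι, σ₁ ≠ σ₂ ∧
        (∃ ε > 0, (∀ s ∈ Set.Ioo (t - ε) t, z s ∈ zones σ₁) ∧
                  (∀ s ∈ Set.Ioo t (t + ε), z s ∈ zones σ₂)) ∧
        (∀ g ∈ curves, g (z t) = 0 →
          fderiv ℝ g (z t) (fields σ₁ (z t)) ≠ 0 ∧
          fderiv ℝ g (z t) (fields σ₂ (z t)) ≠ 0 ∧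
          (0 < fderiv ℝ g (z t) (fields σ₁ (z t)) ↔
           0 < fderiv ℝ g (z t) (fields σ₂ (z t)))))

/-- A *crossing limit cycle*: a crossing periodic orbit whose image is isolated among
the images of crossing periodic orbits. -/
def IsCrossingLimitCycle {ι : Type} (zones : ι → Set ℂ) (fields : ι → ℂ → ℂ)
    (curves : Set (ℂ → ℝ)) (z : ℝ → ℂ) : Prop :=
  IsCrossingPeriodicOrbit zones fields curves z ∧
  ∃ U : Set ℂ, IsOpen U ∧ Set.range z ⊆ U ∧
    ∀ w : ℝ → ℂ, IsCrossingPeriodicOrbit zones fields curves w →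
      Set.range w ⊆ U → Set.range w = Set.range z

/-- The three zones separated by the parallel lines `Im z = 1` and `Im z = -1`:
`Σ₊ = {Im z > 1}`, `Σ_c = {|Im z| < 1}`, `Σ₋ = {Im z < -1}`. -/
def zonesLines : Fin 3 → Set ℂ :=
  ![{z : ℂ | 1 < z.im}, {z : ℂ | |z.im| < 1}, {z : ℂ | z.im < -1}]

/-- The discontinuity curves `Im z = 1` and `Im z = -1`, given by level functions. -/
def curvesLines : Set (ℂ → ℝ) :=
  {fun z => z.im - 1, fun z => z.im + 1}

open Complex Set Filter Topology

/-- algebraic crossing condition at a point -/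
def CrossPt (f : Fin 3 → ℂ → ℂ) (σ₁ σ₂ : Fin 3) (p : ℂ) : Prop :=
  (0 < (f σ₁ p).im ∧ 0 < (f σ₂ p).im) ∨ ((f σ₁ p).im < 0 ∧ (f σ₂ p).im < 0)

/-- crossing condition for a curve at a time -/
def CrossAt (f : Fin 3 → ℂ → ℂ) (w : ℝ → ℂ) (t : ℝ) : Prop :=
  ∃ σ₁ σ₂ : Fin 3, σ₁ ≠ σ₂ ∧
    (∃ ε > 0, (∀ s ∈ Set.Ioo (t - ε) t, w s ∈ zonesLines σ₁) ∧
              (∀ s ∈ Set.Ioo t (t + ε), w s ∈ zonesLines σ₂)) ∧ CrossPt f σ₁ σ₂ (w t)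

lemma onCurve_iff (p : ℂ) : (∃ g ∈ curvesLines, g p = 0) ↔ (p.im = 1 ∨ p.im = -1) := by
  simp only [curvesLines, mem_insert_iff, mem_singleton_iff, exists_eq_or_imp, exists_eq_left]
  constructor
  · rintro (h | h)
    · left; linarith
    · right; linarith
  · rintro (h | h)
    · left; linarith
    · right; linarith

lemma fderiv_im_sub (p v : ℂ) : fderiv ℝ (fun z : ℂ => z.im - 1) p v = v.im := by
  have h : HasFDerivAt (fun z : ℂ => z.im - 1) Complex.imCLM p :=
    (Complex.imCLM.hasFDerivAt (x := p)).sub_const 1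
  rw [h.fderiv]; rfl

lemma fderiv_im_add (p v : ℂ) : fderiv ℝ (fun z : ℂ => z.im + 1) p v = v.im := by
  have h : HasFDerivAt (fun z : ℂ => z.im + 1) Complex.imCLM p :=
    (Complex.imCLM.hasFDerivAt (x := p)).add_const 1
  rw [h.fderiv]; rfl

lemma crossPt_iff (f : Fin 3 → ℂ → ℂ) (σ₁ σ₂ : Fin 3) (p : ℂ) (hp : p.im = 1 ∨ p.im = -1) :
    (∀ g ∈ curvesLines, g p = 0 →
          fderiv ℝ g p (f σ₁ p) ≠ 0 ∧
          fderiv ℝ g p (f σ₂ p) ≠ 0 ∧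
          (0 < fderiv ℝ g p (f σ₁ p) ↔
           0 < fderiv ℝ g p (f σ₂ p))) ↔ CrossPt f σ₁ σ₂ p := by
  simp only [curvesLines, mem_insert_iff, mem_singleton_iff, forall_eq_or_imp, forall_eq,
    fderiv_im_add, fderiv_im_sub, CrossPt]
  have key : ∀ u v : ℝ, (u ≠ 0 ∧ v ≠ 0 ∧ (0 < u ↔ 0 < v)) ↔ ((0 < u ∧ 0 < v) ∨ (u < 0 ∧ v < 0)) := by
    intro u v
    rcases lt_trichotomy u 0 with h | h | h <;> rcases lt_trichotomy v 0 with h' | h' | h' <;>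
      first | (constructor <;> (try rintro ⟨_, _, _⟩) <;> grind) | grind
  simp only [key]
  rcases hp with h | h <;> simp [h] <;> norm_num

/-- reformulated orbit -/
structure Orb (f : Fin 3 → ℂ → ℂ) (w : ℝ → ℂ) : Prop where
  cont : Continuous w
  per : ∃ T, 0 < T ∧ Function.Periodic w T
  der : ∀ t σ, w t ∈ zonesLines σ → HasDerivAt w (f σ (w t)) t
  cross : ∀ t, ((w t).im = 1 ∨ (w t).im = -1) → CrossAt f w t
  ne : ∀ t, w t ≠ 0

lemma orb_of (f : Fin 3 → ℂ → ℂ) (w : ℝ → ℂ)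
    (h : IsCrossingPeriodicOrbit zonesLines f curvesLines w) (h0 : ∀ t, w t ≠ 0) : Orb f w := by
  obtain ⟨T, hT, hc, hp, -, hd, -, hx⟩ := h
  refine ⟨hc, ⟨T, hT, hp⟩, hd, ?_, h0⟩
  intro t ht
  obtain ⟨σ₁, σ₂, h12, hε, hg⟩ := hx t ((onCurve_iff _).2 ht)
  exact ⟨σ₁, σ₂, h12, hε, (crossPt_iff f σ₁ σ₂ _ ht).1 hg⟩

lemma mem_zone0 (p : ℂ) : p ∈ zonesLines 0 ↔ 1 < p.im := Iff.rfl
lemma mem_zone1 (p : ℂ) : p ∈ zonesLines 1 ↔ |p.im| < 1 := Iff.rfl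
lemma mem_zone2 (p : ℂ) : p ∈ zonesLines 2 ↔ p.im < -1 := Iff.rfl

lemma zone_inj (p : ℂ) (σ τ : Fin 3) (h : p ∈ zonesLines σ) (h' : p ∈ zonesLines τ) : σ = τ := by
  fin_cases σ <;> fin_cases τ <;> first | rfl | skip
  all_goals
    simp only [Fin.zero_eta, Fin.mk_one, Fin.reduceFinMk, mem_zone0, mem_zone1, mem_zone2, abs_lt] at h h'
    exfalso; linarith [h, h']

lemma zone_not_curve (p : ℂ) (σ : Fin 3) (h : p ∈ zonesLines σ) : ¬ (p.im = 1 ∨ p.im = -1) := by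
  fin_cases σ <;>
    simp only [Fin.zero_eta, Fin.mk_one, Fin.reduceFinMk, mem_zone0, mem_zone1, mem_zone2, abs_lt] at h <;>
    rintro (h' | h') <;> linarith [h]

lemma zone_open (σ : Fin 3) : IsOpen (zonesLines σ) := by
  fin_cases σ
  · exact isOpen_lt continuous_const Complex.continuous_im
  · exact isOpen_lt Complex.continuous_im.abs continuous_const
  · exact isOpen_lt Complex.continuous_im continuous_const

/-! ### Constructing orbits -/

/-- an admissible path -/
structure IsPath (f : Fin 3 → ℂ → ℂ) (L : ℝ) (F : ℝ → ℂ) (p q : ℂ) (σs σe : Fin 3) : Prop where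
  pos : 0 < L
  cont : ContinuousOn F (Icc 0 L)
  start : F 0 = p
  fnl : F L = q
  ne : ∀ s ∈ Icc 0 L, F s ≠ 0
  zs : ∃ ε > 0, ∀ s ∈ Ioo 0 ε, F s ∈ zonesLines σs
  ze : ∃ ε > 0, ∀ s ∈ Ioo (L - ε) L, F s ∈ zonesLines σe
  der : ∀ s ∈ Ioo 0 L, ∀ σ, F s ∈ zonesLines σ → HasDerivAt F (f σ (F s)) s
  fin : {s ∈ Ioo 0 L | (F s).im = 1 ∨ (F s).im = -1}.Finite
  cross : ∀ s ∈ Ioo 0 L, ((F s).im = 1 ∨ (F s).im = -1) → CrossAt f F s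

/-- solution arc inside a zone -/
structure IsArc (f : Fin 3 → ℂ → ℂ) (σ : Fin 3) (p q : ℂ) (L : ℝ) (E : ℝ → ℂ) : Prop where
  pos : 0 < L
  cont : ContinuousOn E (Icc 0 L)
  start : E 0 = p
  fnl : E L = q
  ne : ∀ s ∈ Icc 0 L, E s ≠ 0
  zone : ∀ s ∈ Ioo 0 L, E s ∈ zonesLines σ
  der : ∀ s ∈ Ioo 0 L, HasDerivAt E (f σ (E s)) s

lemma IsArc.isPath {f : Fin 3 → ℂ → ℂ} {σ : Fin 3} {p q : ℂ} {L : ℝ} {E : ℝ → ℂ}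
    (h : IsArc f σ p q L E) : IsPath f L E p q σ σ where
  pos := h.pos
  cont := h.cont
  start := h.start
  fnl := h.fnl
  ne := h.ne
  zs := ⟨L, h.pos, h.zone⟩
  ze := ⟨L, h.pos, by simpa using h.zone⟩
  der := by
    intro s hs τ hτ
    rw [zone_inj _ _ _ hτ (h.zone s hs)]
    exact h.der s hs
  fin := by
    convert Set.finite_empty
    ext s
    simp only [mem_setOf_eq, mem_empty_iff_false, iff_false]
    rintro ⟨hs, h'⟩
    exact zone_not_curve _ _ (h.zone s hs) h'
  cross := fun s hs h' => absurd h' (zone_not_curve _ _ (h.zone s hs))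

lemma germ_cross {f : Fin 3 → ℂ → ℂ} {F G : ℝ → ℂ} {s t δ : ℝ} (hδ : 0 < δ)
    (h : ∀ r, |r| < δ → G (t + r) = F (s + r)) (hc : CrossAt f F s) : CrossAt f G t := by
  obtain ⟨σ₁, σ₂, h12, ⟨ε, hε, h1, h2⟩, hx⟩ := hc
  refine ⟨σ₁, σ₂, h12, ⟨min ε δ, lt_min hε hδ, ?_, ?_⟩, ?_⟩
  · rintro r ⟨hr, hr'⟩
    have := min_le_left ε δ
    have := min_le_right ε δ
    have e := h (r - t) (by rw [abs_lt]; constructor <;> linarith)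
    rw [show t + (r - t) = r by ring] at e
    rw [e]; apply h1; constructor <;> linarith
  · rintro r ⟨hr, hr'⟩
    have := min_le_left ε δ
    have := min_le_right ε δ
    have e := h (r - t) (by rw [abs_lt]; constructor <;> linarith)
    rw [show t + (r - t) = r by ring] at e
    rw [e]; apply h2; constructor <;> linarith
  · have e := h 0 (by simpa using hδ)
    simp only [add_zero] at e
    rwa [e]

lemma germ_deriv {F G : ℝ → ℂ} {s t δ : ℝ} {v : ℂ} (hδ : 0 < δ)
    (h : ∀ r, |r| < δ → G (t + r) = F (s + r)) (hc : HasDerivAt F v s) : HasDerivAt G v t := by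
  have h1 : HasDerivAt (fun x => F (x + (s - t))) v t := by
    apply HasDerivAt.comp_add_const
    rwa [show t + (s - t) = s by ring]
  refine h1.congr_of_eventuallyEq ?_
  filter_upwards [Metric.ball_mem_nhds t hδ] with x hx
  rw [Metric.mem_ball, Real.dist_eq] at hx
  have := h (x - t) hx
  rw [show t + (x - t) = x by ring] at this
  rw [this]; congr 1; ring

lemma IsPath.trans {f : Fin 3 → ℂ → ℂ} {L₁ L₂ : ℝ} {F₁ F₂ : ℝ → ℂ} {p q r : ℂ}
    {σ₁ σ₂ σ₃ σ₄ : Fin 3} (h₁ : IsPath f L₁ F₁ p q σ₁ σ₂) (h₂ : IsPath f L₂ F₂ q r σ₃ σ₄)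
    (hne : σ₂ ≠ σ₃) (hq : q.im = 1 ∨ q.im = -1) (hx : CrossPt f σ₂ σ₃ q) :
    IsPath f (L₁ + L₂) (fun s => if s ≤ L₁ then F₁ s else F₂ (s - L₁)) p r σ₁ σ₄ := by
  set F : ℝ → ℂ := fun s => if s ≤ L₁ then F₁ s else F₂ (s - L₁) with hF
  have p1 := h₁.pos
  have p2 := h₂.pos
  have e1 : ∀ s, s ≤ L₁ → F s = F₁ s := fun s hs => by simp [hF, hs]
  have e2 : ∀ s, L₁ ≤ s → F s = F₂ (s - L₁) := by
    intro s hs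
    rcases hs.eq_or_lt with h | h
    · subst h; simp [hF, h₁.fnl, h₂.start]
    · simp [hF, h.not_ge]
  have g1 : ∀ s, s < L₁ → ∃ δ > 0, ∀ r, |r| < δ → F (s + r) = F₁ (s + r) := by
    intro s hs
    refine ⟨L₁ - s, by linarith, fun r hr => e1 _ ?_⟩
    linarith [(abs_lt.1 hr).2]
  have g2 : ∀ s, L₁ < s → ∃ δ > 0, ∀ r, |r| < δ → F (s + r) = F₂ ((s - L₁) + r) := by
    intro s hs
    refine ⟨s - L₁, by linarith, fun r hr => ?_⟩
    rw [e2 _ (by linarith [(abs_lt.1 hr).1])]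
    congr 1; ring
  have hm : F L₁ = q := by rw [e1 _ le_rfl, h₁.fnl]
  refine ⟨by linarith, ?_, ?_, ?_, ?_, ?_, ?_, ?_, ?_, ?_⟩
  · rw [← Icc_union_Icc_eq_Icc p1.le (by linarith : L₁ ≤ L₁ + L₂)]
    apply ContinuousOn.union_of_isClosed _ _ isClosed_Icc isClosed_Icc
    · exact h₁.cont.congr fun s hs => e1 s hs.2
    · have : ContinuousOn (fun s => F₂ (s - L₁)) (Icc L₁ (L₁ + L₂)) := by
        apply h₂.cont.comp (by fun_prop)
        intro s hs
        constructor <;> linarith [hs.1, hs.2]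
      exact this.congr fun s hs => e2 s hs.1
  · rw [e1 _ p1.le, h₁.start]
  · rw [e2 _ (by linarith), add_sub_cancel_left, h₂.fnl]
  · intro s hs
    rcases le_total s L₁ with h | h
    · rw [e1 s h]; exact h₁.ne s ⟨hs.1, h⟩
    · rw [e2 s h]; exact h₂.ne _ ⟨by linarith, by linarith [hs.2]⟩
  · obtain ⟨ε, hε, h⟩ := h₁.zs
    refine ⟨min ε L₁, lt_min hε p1, fun s hs => ?_⟩
    rw [e1 s (hs.2.le.trans (min_le_right _ _))]
    exact h s ⟨hs.1, hs.2.trans_le (min_le_left _ _)⟩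
  · obtain ⟨ε, hε, h⟩ := h₂.ze
    refine ⟨min ε L₂, lt_min hε p2, fun s hs => ?_⟩
    have := min_le_left ε L₂
    have := min_le_right ε L₂
    have := hs.1
    have := hs.2
    rw [e2 s (by linarith)]
    exact h _ ⟨by linarith, by linarith⟩
  · intro s hs σ hσ
    rcases lt_trichotomy s L₁ with h | h | h
    · obtain ⟨δ, hδ, g⟩ := g1 s h
      apply germ_deriv hδ g
      rw [e1 s h.le] at hσ ⊢
      exact h₁.der s ⟨hs.1, h⟩ σ hσ
    · subst h
      rw [hm] at hσ
      exact absurd hq (zone_not_curve _ _ hσ)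
    · obtain ⟨δ, hδ, g⟩ := g2 s h
      apply germ_deriv hδ g
      rw [e2 s h.le] at hσ ⊢
      exact h₂.der _ ⟨by linarith, by linarith [hs.2]⟩ σ hσ
  · refine ((h₁.fin.union (Set.finite_singleton L₁)).union
      (h₂.fin.image (fun s => s + L₁))).subset ?_
    rintro s ⟨hs, hc⟩
    rcases lt_trichotomy s L₁ with h | h | h
    · left; left
      rw [e1 s h.le] at hc
      exact ⟨⟨hs.1, h⟩, hc⟩
    · left; right; exact h
    · right
      rw [e2 s h.le] at hc
      exact ⟨s - L₁, ⟨⟨by linarith, by linarith [hs.2]⟩, hc⟩, by simp⟩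
  · intro s hs hc
    rcases lt_trichotomy s L₁ with h | h | h
    · obtain ⟨δ, hδ, g⟩ := g1 s h
      rw [e1 s h.le] at hc
      exact germ_cross hδ g (h₁.cross s ⟨hs.1, h⟩ hc)
    · subst h
      obtain ⟨ε, hε, k1⟩ := h₁.ze
      obtain ⟨ε', hε', k2⟩ := h₂.zs
      refine ⟨σ₂, σ₃, hne, ⟨min ε ε', lt_min hε hε', ?_, ?_⟩, by rwa [hm]⟩
      · intro r hr
        rw [e1 r hr.2.le]
        have := min_le_left ε ε'
        exact k1 r ⟨by linarith [hr.1], hr.2⟩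
      · intro r hr
        rw [e2 r hr.1.le]
        have := min_le_right ε ε'
        exact k2 _ ⟨by linarith [hr.1], by linarith [hr.2]⟩
    · obtain ⟨δ, hδ, g⟩ := g2 s h
      rw [e2 s h.le] at hc
      exact germ_cross hδ g (h₂.cross _ ⟨by linarith, by linarith [hs.2]⟩ hc)

lemma IsPath.close {f : Fin 3 → ℂ → ℂ} {L : ℝ} {F : ℝ → ℂ} {p : ℂ}
    {σ₁ σ₂ : Fin 3} (h : IsPath f L F p p σ₁ σ₂)
    (hne : σ₂ ≠ σ₁) (hp : p.im = 1 ∨ p.im = -1) (hx : CrossPt f σ₂ σ₁ p) :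
    ∃ z : ℝ → ℂ, IsCrossingPeriodicOrbit zonesLines f curvesLines z ∧ (∀ t, z t ≠ 0) ∧ z 0 = p := by
  have hL := h.pos
  haveI : Fact (0 < L) := ⟨hL⟩
  set z : ℝ → ℂ := fun t => AddCircle.liftIco L 0 F (t : AddCircle L) with hz
  have hcont : Continuous z := by
    refine (AddCircle.liftIco_continuous ?_ ?_).comp (AddCircle.continuous_mk' L)
    · rw [zero_add, h.start, h.fnl]
    · rw [zero_add]; exact h.cont
  have hper : Function.Periodic z L := by
    intro t; simp [hz]
  have e0 : ∀ s ∈ Ico 0 L, z s = F s := by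
    intro s hs
    exact AddCircle.liftIco_coe_apply (by simpa using hs)
  have z0 : z 0 = p := by rw [e0 0 ⟨le_rfl, hL⟩, h.start]
  -- representation
  have rep : ∀ t, ∃ s ∈ Ico 0 L, ∀ r, z (t + r) = z (s + r) := by
    intro t
    refine ⟨toIcoMod hL 0 t, by simpa using toIcoMod_mem_Ico hL 0 t, fun r => ?_⟩
    have : t + r = toIcoMod hL 0 t + r + toIcoDiv hL 0 t • L := by
      have := toIcoMod_add_toIcoDiv_zsmul hL 0 t
      linarith
    rw [this]
    exact hper.zsmul _ _
  have g1 : ∀ s ∈ Ioo 0 L, ∃ δ > 0, ∀ r, |r| < δ → z (s + r) = F (s + r) := by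
    intro s hs
    refine ⟨min s (L - s), lt_min hs.1 (by linarith [hs.2]), fun r hr => e0 _ ?_⟩
    have := min_le_left s (L - s)
    have := min_le_right s (L - s)
    have := abs_lt.1 hr
    constructor <;> linarith
  have hcross : ∀ t, ((z t).im = 1 ∨ (z t).im = -1) → CrossAt f z t := by
    intro t ht
    obtain ⟨s, hs, e⟩ := rep t
    have es := e 0
    simp only [add_zero] at es
    refine germ_cross (s := s) one_pos (fun r _ => e r) ?_
    rw [es] at ht
    rcases hs.1.eq_or_lt with h0 | h0
    · subst h0
      obtain ⟨ε, hε, k1⟩ := h.ze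
      obtain ⟨ε', hε', k2⟩ := h.zs
      refine ⟨σ₂, σ₁, hne, ⟨min L (min ε ε'), lt_min hL (lt_min hε hε'), ?_, ?_⟩, by rwa [z0]⟩
      · intro r hr
        have := min_le_left ε ε'
        have := min_le_left L (min ε ε')
        have := min_le_right L (min ε ε')
        have := hr.1
        have := hr.2
        rw [← hper r, e0 _ ⟨by linarith, by linarith⟩]
        exact k1 _ ⟨by linarith, by linarith⟩
      · intro r hr
        have := min_le_right ε ε'
        have := min_le_left L (min ε ε')
        have := min_le_right L (min ε ε')
        have := hr.1
        have := hr.2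
        rw [e0 _ ⟨by linarith, by linarith⟩]
        exact k2 _ ⟨by linarith, by linarith⟩
    · obtain ⟨δ, hδ, g⟩ := g1 s ⟨h0, hs.2⟩
      rw [e0 s hs] at ht
      exact germ_cross hδ g (h.cross s ⟨h0, hs.2⟩ ht)
  refine ⟨z, ⟨L, hL, hcont, hper, ?_, ?_, ?_, ?_⟩, ?_, z0⟩
  · obtain ⟨ε, hε, k⟩ := h.zs
    refine ⟨0, min (ε / 2) (L / 2), fun hc => ?_⟩
    have h1 := min_le_left (ε / 2) (L / 2)
    have h2 := min_le_right (ε / 2) (L / 2)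
    have h3 : 0 < min (ε / 2) (L / 2) := lt_min (by linarith) (by linarith)
    rw [z0, e0 _ ⟨h3.le, by linarith⟩] at hc
    have := k _ ⟨h3, by linarith⟩
    rw [← hc] at this
    exact zone_not_curve _ _ this hp
  · intro t σ hσ
    obtain ⟨s, hs, e⟩ := rep t
    have es := e 0
    simp only [add_zero] at es
    refine germ_deriv (s := s) one_pos (fun r _ => e r) ?_
    rw [es] at hσ ⊢
    rcases hs.1.eq_or_lt with h0 | h0
    · subst h0
      rw [z0] at hσ
      exact absurd hp (zone_not_curve _ _ hσ)
    · obtain ⟨δ, hδ, g⟩ := g1 s ⟨h0, hs.2⟩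
      apply germ_deriv hδ g
      rw [e0 s hs] at hσ ⊢
      exact h.der s ⟨h0, hs.2⟩ σ hσ
  · refine (h.fin.union (Set.finite_singleton 0)).subset ?_
    rintro s ⟨hs, hc⟩
    rw [onCurve_iff, e0 s hs] at hc
    rcases hs.1.eq_or_lt with h0 | h0
    · right; exact h0.symm
    · left; exact ⟨⟨h0, hs.2⟩, hc⟩
  · intro t ht
    rw [onCurve_iff] at ht
    obtain ⟨σ₁, σ₂, h12, hε, hg⟩ := hcross t ht
    exact ⟨σ₁, σ₂, h12, hε, (crossPt_iff f σ₁ σ₂ _ ht).2 hg⟩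
  · intro t
    obtain ⟨s, hs, e⟩ := rep t
    have es := e 0
    simp only [add_zero] at es
    rw [es, e0 s hs]
    exact h.ne s ⟨hs.1, hs.2.le⟩

/-! ### Uniqueness along a zone -/

lemma const_of_deriv_zero {h : ℝ → ℂ} {s : ℝ} (hs : 0 ≤ s) (hc : ContinuousOn h (Icc 0 s))
    (hd : ∀ r ∈ Ioo 0 s, HasDerivAt h 0 r) : h s = h 0 := by
  have := intervalIntegral.integral_eq_sub_of_hasDerivAt_of_le (f := h) (f' := fun _ => 0) hs hc hd
    (by simp)
  simp at this
  exact (sub_eq_zero.1 this.symm)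

/-- forward uniqueness for nonvanishing solutions in a zone -/
def Uniq (f : Fin 3 → ℂ → ℂ) (σ : Fin 3) : Prop :=
  ∀ (u v : ℝ → ℂ) (s : ℝ), 0 < s → ContinuousOn u (Icc 0 s) → ContinuousOn v (Icc 0 s) →
    (∀ r ∈ Icc 0 s, u r ≠ 0) → (∀ r ∈ Icc 0 s, v r ≠ 0) →
    (∀ r ∈ Ioo 0 s, HasDerivAt u (f σ (u r)) r) → (∀ r ∈ Ioo 0 s, HasDerivAt v (f σ (v r)) r) →
    u 0 = v 0 → u s = v s

lemma uniq_linear (f : Fin 3 → ℂ → ℂ) (σ : Fin 3) (lam ctr : ℂ)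
    (hf : ∀ w, f σ w = lam * (w - ctr)) : Uniq f σ := by
  intro u v s hs hu hv _ _ du dv h0
  have key : (fun r : ℝ => (u r - v r) * Complex.exp (-lam * r)) s =
      (fun r : ℝ => (u r - v r) * Complex.exp (-lam * r)) 0 := by
    apply const_of_deriv_zero hs.le
    · apply (hu.sub hv).mul
      fun_prop
    · intro r hr
      have h1 : HasDerivAt (fun r : ℝ => Complex.exp (-lam * r)) (Complex.exp (-lam * r) * -lam) r := by
        have : HasDerivAt (fun x : ℂ => Complex.exp (-lam * x)) (Complex.exp (-lam * r) * -lam) (r : ℂ) := by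
          have := ((hasDerivAt_id (r : ℂ)).const_mul (-lam)).cexp
          simpa using this
        exact this.comp_ofReal
      have h2 := ((du r hr).sub (dv r hr)).mul h1
      refine h2.congr_deriv ?_
      simp only [hf, Pi.sub_apply]; ring
  simp only [h0, sub_self, zero_mul] at key
  rcases mul_eq_zero.1 key with h | h
  · exact sub_eq_zero.1 h
  · exact absurd h (Complex.exp_ne_zero _)

lemma sq_const {f : Fin 3 → ℂ → ℂ} {σ : Fin 3} (hf : ∀ w, f σ w = I / w)
    {u : ℝ → ℂ} {s : ℝ} (hs : 0 ≤ s) (hu : ContinuousOn u (Icc 0 s))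
    (nu : ∀ r ∈ Icc 0 s, u r ≠ 0) (du : ∀ r ∈ Ioo 0 s, HasDerivAt u (f σ (u r)) r) :
    u s ^ 2 = u 0 ^ 2 + 2 * I * s := by
  have key : (fun r : ℝ => u r ^ 2 - 2 * I * r) s = (fun r : ℝ => u r ^ 2 - 2 * I * r) 0 := by
    apply const_of_deriv_zero hs
    · apply (hu.pow 2).sub
      fun_prop
    · intro r hr
      have h1 : HasDerivAt (fun r : ℝ => 2 * I * (r : ℂ)) (2 * I) r := by
        have : HasDerivAt (fun x : ℂ => 2 * I * x) (2 * I) (r : ℂ) := by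
          simpa using (hasDerivAt_id (r : ℂ)).const_mul (2 * I)
        exact this.comp_ofReal
      have h2 := ((du r hr).pow 2).sub h1
      refine h2.congr_deriv ?_
      have := nu r ⟨hr.1.le, hr.2.le⟩
      rw [hf]
      simp only [Nat.cast_ofNat, Nat.add_one_sub_one, pow_one]
      field_simp
      simp
  simp only at key
  have e := sub_eq_iff_eq_add.1 key
  rw [e]; simp

lemma uniq_center (f : Fin 3 → ℂ → ℂ) (σ : Fin 3) (hf : ∀ w, f σ w = I / w) : Uniq f σ := by
  intro u v s hs hu hv nu nv du dv h0
  have hsq : EqOn (u ^ 2) (v ^ 2) (Icc 0 s) := by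
    intro r hr
    have sub1 : Icc 0 r ⊆ Icc 0 s := Icc_subset_Icc_right hr.2
    have sub2 : Ioo 0 r ⊆ Ioo 0 s := Ioo_subset_Ioo_right hr.2
    have e1 := sq_const hf hr.1 (hu.mono sub1) (fun x hx => nu x (sub1 hx))
      (fun x hx => du x (sub2 hx))
    have e2 := sq_const hf hr.1 (hv.mono sub1) (fun x hx => nv x (sub1 hx))
      (fun x hx => dv x (sub2 hx))
    simp only [Pi.pow_apply]
    rw [e1, e2, h0]
  exact isPreconnected_Icc.eq_of_sq_eq hu hv hsq (fun {x} hx => nv x hx) (y := 0) ⟨le_rfl, hs.le⟩ h0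
    ⟨hs.le, le_rfl⟩

/-! ### Determinism -/

/-- every orbit through `p` passes through `q` along a path depending only on `p` -/
def Det (f : Fin 3 → ℂ → ℂ) (p q : ℂ) : Prop :=
  ∃ L > 0, ∃ F : ℝ → ℂ, ∀ w, Orb f w → ∀ t0, w t0 = p →
    (∀ s ∈ Icc 0 L, w (t0 + s) = F s) ∧ w (t0 + L) = q

lemma Det.trans {f : Fin 3 → ℂ → ℂ} {p q r : ℂ} (h₁ : Det f p q) (h₂ : Det f q r) :
    Det f p r := by
  obtain ⟨L₁, p1, F₁, k1⟩ := h₁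
  obtain ⟨L₂, p2, F₂, k2⟩ := h₂
  refine ⟨L₁ + L₂, by positivity, fun s => if s ≤ L₁ then F₁ s else F₂ (s - L₁), ?_⟩
  intro w hw t0 h0
  obtain ⟨a1, b1⟩ := k1 w hw t0 h0
  obtain ⟨a2, b2⟩ := k2 w hw _ b1
  refine ⟨?_, by rw [← b2]; congr 1; ring⟩
  intro s hs
  by_cases h : s ≤ L₁
  · simp only [h, if_true]; exact a1 s ⟨hs.1, h⟩
  · simp only [h, if_false]
    push Not at h
    rw [← a2 (s - L₁) ⟨by linarith, by linarith [hs.2]⟩]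
    congr 1; ring

lemma det_range {f : Fin 3 → ℂ → ℂ} {p : ℂ} (h : Det f p p) {w w' : ℝ → ℂ} (hw : Orb f w)
    (hw' : Orb f w') (hp : p ∈ range w) (hp' : p ∈ range w') : range w = range w' := by
  obtain ⟨L, hL, F, k⟩ := h
  have key : ∀ w, Orb f w → p ∈ range w → range w = F '' (Icc 0 L) := by
    rintro w hw ⟨t0, h0⟩
    have it : ∀ n : ℕ, w (t0 + n * L) = p := by
      intro n
      induction n with
      | zero => simpa using h0
      | succ n ih =>
        rw [← (k w hw _ ih).2]; congr 1; push_cast; ring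
    ext y
    constructor
    · rintro ⟨t, rfl⟩
      obtain ⟨T, hT, hper⟩ := hw.per
      obtain ⟨n, hn⟩ := exists_nat_gt ((t0 - t) / T)
      rw [div_lt_iff₀ hT] at hn
      have e : w t = w (t + n * T) := (hper.nat_mul n t).symm
      set u := t + n * T - t0 with hu
      have hu0 : 0 ≤ u := by rw [hu]; linarith
      have f1 := Nat.floor_le (div_nonneg hu0 hL.le)
      have f2 := Nat.lt_floor_add_one (u / L)
      rw [le_div_iff₀ hL] at f1
      rw [div_lt_iff₀ hL] at f2
      refine ⟨u - (⌊u / L⌋₊ : ℝ) * L, ⟨by linarith, by linarith⟩, ?_⟩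
      rw [← (k w hw _ (it ⌊u / L⌋₊)).1 _ ⟨by linarith, by linarith⟩, e]
      congr 1; rw [hu]; ring
    · rintro ⟨s, hs, rfl⟩
      exact ⟨t0 + s, (k w hw t0 h0).1 s hs⟩
  rw [key w hw hp, key w' hw' hp']

lemma det_of_arc {f : Fin 3 → ℂ → ℂ} {σ : Fin 3} {p q : ℂ} {L : ℝ} {E : ℝ → ℂ}
    (h : IsArc f σ p q L E) (hu : Uniq f σ)
    (hen : ∀ w, Orb f w → ∀ t0, w t0 = p →
      ∃ ε > 0, ∀ s ∈ Ioo t0 (t0 + ε), w s ∈ zonesLines σ) : Det f p q := by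
  have hL := h.pos
  refine ⟨L, hL, E, ?_⟩
  intro w hw t0 h0
  set A : Set ℝ := {s | ∀ r, 0 < r → w (t0 + r) ∉ zonesLines σ → s ≤ r} with hA
  have agree : ∀ s ∈ A, s ∈ Icc 0 L → w (t0 + s) = E s := by
    intro s hsA hs
    rcases hs.1.eq_or_lt with e | e
    · subst e; rw [add_zero, h0, h.start]
    · refine hu (fun r => w (t0 + r)) E s e ?_ ?_ ?_ ?_ ?_ ?_ ?_
      · exact (hw.cont.comp (by fun_prop : Continuous fun r : ℝ => t0 + r)).continuousOn
      · exact h.cont.mono (Icc_subset_Icc_right hs.2)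
      · exact fun r _ => hw.ne _
      · exact fun r hr => h.ne r ⟨hr.1, hr.2.trans hs.2⟩
      · intro r hr
        have hz : w (t0 + r) ∈ zonesLines σ := by
          by_contra hz
          linarith [hsA r hr.1 hz, hr.2]
        exact (hw.der _ _ hz).comp_const_add t0 r
      · exact fun r hr => h.der r ⟨hr.1, hr.2.trans_le hs.2⟩
      · simp [h0, h.start]
  have hsub : Icc 0 L ⊆ A := by
    apply IsClosed.Icc_subset_of_forall_exists_gt
    · apply IsClosed.inter _ isClosed_Icc
      have : A = ⋂ r, ⋂ (_ : 0 < r), ⋂ (_ : w (t0 + r) ∉ zonesLines σ), Iic r := by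
        ext s; simp [hA]
      rw [this]
      exact isClosed_iInter fun r => isClosed_iInter fun _ => isClosed_iInter fun _ => isClosed_Iic
    · intro r hr _; exact hr.le
    · rintro x ⟨hxA, hx⟩ y hy
      have hy : x < y := hy
      have : ∃ ε > 0, ∀ r, 0 < r → x ≤ r → r < x + ε → w (t0 + r) ∈ zonesLines σ := by
        rcases hx.1.eq_or_lt with e | e
        · obtain ⟨ε, hε, k⟩ := hen w hw t0 h0
          exact ⟨ε, hε, fun r h1 h2 h3 => k _ ⟨by linarith, by linarith⟩⟩
        · have hxz : w (t0 + x) ∈ zonesLines σ := by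
            rw [agree x hxA ⟨hx.1, hx.2.le⟩]; exact h.zone x ⟨e, hx.2⟩
          have ho : IsOpen ((fun r => w (t0 + r)) ⁻¹' zonesLines σ) :=
            (zone_open σ).preimage (hw.cont.comp (by fun_prop))
          obtain ⟨ε, hε, k⟩ := Metric.isOpen_iff.1 ho x hxz
          refine ⟨ε, hε, fun r h1 h2 h3 => k ?_⟩
          rw [Metric.mem_ball, Real.dist_eq, abs_lt]; constructor <;> linarith
      obtain ⟨ε, hε, k⟩ := this
      refine ⟨min y (x + ε), ?_, lt_min hy (by linarith), min_le_left _ _⟩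
      intro r hr hrz
      by_contra hlt
      push Not at hlt
      have h1 := min_le_right y (x + ε)
      rcases lt_or_ge r x with h2 | h2
      · linarith [hxA r hr hrz]
      · exact hrz (k r hr h2 (by linarith))
  refine ⟨fun s hs => agree s (hsub hs) hs, ?_⟩
  rw [agree L (hsub ⟨hL.le, le_rfl⟩) ⟨hL.le, le_rfl⟩, h.fnl]

lemma push_im {f : Fin 3 → ℂ → ℂ} {w : ℝ → ℂ} (hw : Orb f w) {t0 ε k : ℝ} {σ : Fin 3}
    (hε : 0 < ε) (hz : ∀ s ∈ Ioo t0 (t0 + ε), w s ∈ zonesLines σ)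
    (hc : ContinuousAt (f σ) (w t0)) (hk : 0 < k * (f σ (w t0)).im) :
    ∃ s ∈ Ioo t0 (t0 + ε), 0 < k * ((w s).im - (w t0).im) := by
  have hc' : ContinuousAt (fun t => k * (f σ (w t)).im) t0 := by
    have : ContinuousAt (fun t => f σ (w t)) t0 := ContinuousAt.comp hc hw.cont.continuousAt
    exact (Complex.continuous_im.continuousAt.comp this).const_mul k
  have hev := hc'.eventually (lt_mem_nhds hk)
  obtain ⟨δ, hδ, hd⟩ := Metric.eventually_nhds_iff.1 hev
  set η := min δ ε / 2 with hη
  have m1 := min_le_left δ ε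
  have m2 := min_le_right δ ε
  have m3 : 0 < min δ ε := lt_min hδ hε
  have hη0 : 0 < η := by linarith
  refine ⟨t0 + η, ⟨by linarith, by linarith⟩, ?_⟩
  have mono : StrictMonoOn (fun t => k * (w t).im) (Icc t0 (t0 + η)) := by
    apply strictMonoOn_of_deriv_pos (convex_Icc _ _)
    · exact (continuous_const.mul (Complex.continuous_im.comp hw.cont)).continuousOn
    · intro x hx
      rw [interior_Icc] at hx
      have h1 := hw.der x σ (hz x ⟨hx.1, by linarith [hx.2]⟩)
      have h2 : HasDerivAt (fun t => (w t).im) (f σ (w x)).im x :=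
        (Complex.imCLM.hasFDerivAt (x := w x)).comp_hasDerivAt x h1
      rw [(h2.const_mul k).deriv]
      apply hd
      rw [Real.dist_eq, abs_lt]; constructor <;> linarith [hx.1, hx.2]
  have := mono ⟨le_rfl, by linarith⟩ ⟨by linarith, le_rfl⟩ (by linarith : t0 < t0 + η)
  simp only at this
  linarith

lemma near_closure {w : ℝ → ℂ} (hw : Continuous w) {t0 ε : ℝ} {σ : Fin 3}
    (hε : 0 < ε) (hz : ∀ s ∈ Ioo t0 (t0 + ε), w s ∈ zonesLines σ) :
    w t0 ∈ closure (zonesLines σ) := by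
  have h1 : t0 ∈ closure (Ioo t0 (t0 + ε)) := by
    rw [closure_Ioo (by linarith)]; constructor <;> linarith
  exact map_mem_closure hw h1 hz

lemma near_closure_left {w : ℝ → ℂ} (hw : Continuous w) {t0 ε : ℝ} {σ : Fin 3}
    (hε : 0 < ε) (hz : ∀ s ∈ Ioo (t0 - ε) t0, w s ∈ zonesLines σ) :
    w t0 ∈ closure (zonesLines σ) := by
  have h1 : t0 ∈ closure (Ioo (t0 - ε) t0) := by
    rw [closure_Ioo (by linarith)]; constructor <;> linarith
  exact map_mem_closure hw h1 hz

lemma closure_zone0 (q : ℂ) (h : q ∈ closure (zonesLines 0)) : 1 ≤ q.im :=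
  closure_minimal (s := zonesLines 0) (t := {q : ℂ | 1 ≤ q.im}) (fun q hq => le_of_lt (show 1 < q.im from hq))
    (isClosed_le continuous_const Complex.continuous_im) h

lemma closure_zone2 (q : ℂ) (h : q ∈ closure (zonesLines 2)) : q.im ≤ -1 :=
  closure_minimal (s := zonesLines 2) (t := {q : ℂ | q.im ≤ -1}) (fun q hq => le_of_lt (show q.im < -1 from hq))
    (isClosed_le Complex.continuous_im continuous_const) h

lemma enter {f : Fin 3 → ℂ → ℂ} {p : ℂ} (hp : p.im = 1 ∨ p.im = -1) (σ : Fin 3)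
    (h : ∀ τ, τ ≠ σ → p ∉ closure (zonesLines τ) ∨
      ∃ k : ℝ, ContinuousAt (f τ) p ∧ 0 < k * (f τ p).im ∧
        ∀ q ∈ zonesLines τ, k * (q.im - p.im) ≤ 0) :
    ∀ w, Orb f w → ∀ t0, w t0 = p → ∃ ε > 0, ∀ s ∈ Ioo t0 (t0 + ε), w s ∈ zonesLines σ := by
  rintro w hw t0 rfl
  obtain ⟨σ₁, τ, -, ⟨ε, hε, -, hz⟩, -⟩ := hw.cross t0 hp
  by_cases e : τ = σ
  · subst e; exact ⟨ε, hε, hz⟩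
  · exfalso
    rcases h τ e with h' | ⟨k, hc, hk, hq⟩
    · exact h' (near_closure hw.cont hε hz)
    · obtain ⟨s, hs, hs'⟩ := push_im hw hε hz hc hk
      linarith [hq _ (hz s hs)]

lemma enter_top_up {f : Fin 3 → ℂ → ℂ} {p : ℂ} (hp : p.im = 1) (hc : ContinuousAt (f 1) p)
    (hk : 0 < (f 1 p).im) :
    ∀ w, Orb f w → ∀ t0, w t0 = p → ∃ ε > 0, ∀ s ∈ Ioo t0 (t0 + ε), w s ∈ zonesLines 0 := by
  apply enter (Or.inl hp)
  intro τ hτ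
  fin_cases τ
  · exact absurd rfl hτ
  · right
    refine ⟨1, hc, by simpa using hk, fun q hq => ?_⟩
    have : |q.im| < 1 := hq
    rw [abs_lt] at this
    linarith
  · left; intro h; linarith [closure_zone2 p h]

lemma enter_top_down {f : Fin 3 → ℂ → ℂ} {p : ℂ} (hp : p.im = 1) (hc : ContinuousAt (f 0) p)
    (hk : (f 0 p).im < 0) :
    ∀ w, Orb f w → ∀ t0, w t0 = p → ∃ ε > 0, ∀ s ∈ Ioo t0 (t0 + ε), w s ∈ zonesLines 1 := by
  apply enter (Or.inl hp)
  intro τ hτ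
  fin_cases τ
  · right
    refine ⟨-1, hc, by simpa using hk, fun q hq => ?_⟩
    have : 1 < q.im := hq
    linarith
  · exact absurd rfl hτ
  · left; intro h; linarith [closure_zone2 p h]

lemma enter_bot_down {f : Fin 3 → ℂ → ℂ} {p : ℂ} (hp : p.im = -1) (hc : ContinuousAt (f 1) p)
    (hk : (f 1 p).im < 0) :
    ∀ w, Orb f w → ∀ t0, w t0 = p → ∃ ε > 0, ∀ s ∈ Ioo t0 (t0 + ε), w s ∈ zonesLines 2 := by
  apply enter (Or.inr hp)
  intro τ hτ
  fin_cases τ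
  · left; intro h; linarith [closure_zone0 p h]
  · right
    refine ⟨-1, hc, by simpa using hk, fun q hq => ?_⟩
    have : |q.im| < 1 := hq
    rw [abs_lt] at this
    linarith
  · exact absurd rfl hτ

lemma enter_bot_up {f : Fin 3 → ℂ → ℂ} {p : ℂ} (hp : p.im = -1) (hc : ContinuousAt (f 2) p)
    (hk : 0 < (f 2 p).im) :
    ∀ w, Orb f w → ∀ t0, w t0 = p → ∃ ε > 0, ∀ s ∈ Ioo t0 (t0 + ε), w s ∈ zonesLines 1 := by
  apply enter (Or.inr hp)
  intro τ hτ
  fin_cases τ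
  · left; intro h; linarith [closure_zone0 p h]
  · exact absurd rfl hτ
  · right
    refine ⟨1, hc, by simpa using hk, fun q hq => ?_⟩
    have : q.im < -1 := hq
    linarith

/-- signs at crossings -/
lemma sign_top {f : Fin 3 → ℂ → ℂ} {w : ℝ → ℂ} (hw : Orb f w) {t : ℝ} (h : (w t).im = 1) :
    CrossPt f 0 1 (w t) := by
  obtain ⟨σ₁, σ₂, h12, ⟨ε, hε, h1, h2⟩, hx⟩ := hw.cross t (Or.inl h)
  have c1 := near_closure_left hw.cont hε h1
  have c2 := near_closure hw.cont hε h2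
  have n1 : σ₁ ≠ 2 := by rintro rfl; linarith [closure_zone2 _ c1]
  have n2 : σ₂ ≠ 2 := by rintro rfl; linarith [closure_zone2 _ c2]
  unfold CrossPt at *
  fin_cases σ₁ <;> fin_cases σ₂ <;> simp_all <;> tauto

lemma sign_bot {f : Fin 3 → ℂ → ℂ} {w : ℝ → ℂ} (hw : Orb f w) {t : ℝ} (h : (w t).im = -1) :
    CrossPt f 1 2 (w t) := by
  obtain ⟨σ₁, σ₂, h12, ⟨ε, hε, h1, h2⟩, hx⟩ := hw.cross t (Or.inr h)
  have c1 := near_closure_left hw.cont hε h1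
  have c2 := near_closure hw.cont hε h2
  have n1 : σ₁ ≠ 0 := by rintro rfl; linarith [closure_zone0 _ c1]
  have n2 : σ₂ ≠ 0 := by rintro rfl; linarith [closure_zone0 _ c2]
  unfold CrossPt at *
  fin_cases σ₁ <;> fin_cases σ₂ <;> simp_all <;> tauto

/-! ### Explicit arcs -/

lemma exp_lin (a b s : ℝ) : (Complex.exp (((a : ℂ) + b * I) * s)).im = Real.exp (a * s) * Real.sin (b * s) := by
  rw [Complex.exp_im]; simp

lemma arc_spiral {f : Fin 3 → ℂ → ℂ} {σ : Fin 3} {a b r : ℝ} {ctr : ℂ} (hb : 0 < b) (hr : r ≠ 0)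
    (hf : ∀ w, f σ w = ((a : ℂ) + b * I) * (w - ctr))
    (hz : ∀ q : ℂ, 0 < r * (q.im - ctr.im) → q ∈ zonesLines σ)
    (hne : ∀ q : ℂ, 0 ≤ r * (q.im - ctr.im) → q ≠ 0) :
    IsArc f σ (ctr + r) (ctr - ((r * Real.exp (a * Real.pi / b) : ℝ) : ℂ)) (Real.pi / b)
      (fun s => ctr + r * Complex.exp (((a : ℂ) + b * I) * s)) := by
  have him : ∀ s : ℝ, r * ((ctr + r * Complex.exp (((a : ℂ) + b * I) * s)).im - ctr.im) =
      r ^ 2 * Real.exp (a * s) * Real.sin (b * s) := by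
    intro s
    rw [Complex.add_im, Complex.im_ofReal_mul]
    rw [exp_lin]; ring
  refine ⟨by positivity, ?_, ?_, ?_, ?_, ?_, ?_⟩
  · fun_prop
  · simp
  · have : ((a : ℂ) + b * I) * ((Real.pi / b : ℝ) : ℂ) = ((a * Real.pi / b : ℝ) : ℂ) + Real.pi * I := by
      have : (b : ℂ) ≠ 0 := by exact_mod_cast hb.ne'
      push_cast; field_simp
    rw [this, Complex.exp_add, Complex.exp_pi_mul_I]
    push_cast; ring
  · intro s hs
    apply hne
    rw [him]
    have := Real.sin_nonneg_of_nonneg_of_le_pi (x := b * s) (mul_nonneg hb.le hs.1)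
      (by have := hs.2; rw [le_div_iff₀ hb] at this; linarith)
    positivity
  · intro s hs
    apply hz
    rw [him]
    have := Real.sin_pos_of_pos_of_lt_pi (x := b * s) (mul_pos hb hs.1)
      (by have := hs.2; rw [lt_div_iff₀ hb] at this; linarith)
    positivity
  · intro s hs
    rw [hf]
    have h1 : HasDerivAt (fun x : ℂ => ctr + r * Complex.exp (((a : ℂ) + b * I) * x))
        (((a : ℂ) + b * I) * (ctr + r * Complex.exp (((a : ℂ) + b * I) * s) - ctr)) (s : ℂ) := by
      have := ((((hasDerivAt_id (s : ℂ)).const_mul ((a : ℂ) + b * I)).cexp).const_mul (r : ℂ)).const_add ctr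
      refine this.congr_deriv ?_
      simp only [id]; ring
    exact h1.comp_ofReal

lemma arc_center {f : Fin 3 → ℂ → ℂ} {k Y : ℝ} (hY : 1 < Y) (hk : k ^ 2 = 1)
    (hf : ∀ w, f 1 w = I / w) :
    IsArc f 1 (k * (Y - I)) (k * (Y + I)) (2 * Y)
      (fun s => k * ((((Y ^ 2 - 1 : ℝ) : ℂ) + (2 * s - 2 * Y) * I) ^ (2⁻¹ : ℂ))) := by
  set ζ : ℝ → ℂ := fun s => ((Y ^ 2 - 1 : ℝ) : ℂ) + (2 * s - 2 * Y) * I with hζ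
  have hre : ∀ s, (ζ s).re = Y ^ 2 - 1 := by intro s; simp [hζ, ← Complex.ofReal_pow]
  have him : ∀ s, (ζ s).im = 2 * s - 2 * Y := by intro s; simp [hζ, ← Complex.ofReal_pow]
  have hY2 : 0 < Y ^ 2 - 1 := by nlinarith
  have hslit : ∀ s, ζ s ∈ slitPlane := by intro s; left; rw [hre]; exact hY2
  have hζ0 : ∀ s, ζ s ≠ 0 := fun s => slitPlane_ne_zero (hslit s)
  have hsq : ∀ s, (ζ s ^ (2⁻¹ : ℂ)) ^ 2 = ζ s := by
    intro s
    have := Complex.cpow_nat_inv_pow (ζ s) (n := 2) (by norm_num)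
    simpa using this
  have hS0 : ∀ s, ζ s ^ (2⁻¹ : ℂ) ≠ 0 := by
    intro s h
    have := hsq s
    rw [h] at this
    exact hζ0 s (by rw [← this]; simp)
  have hk0 : k ≠ 0 := by rintro rfl; norm_num at hk
  have hkc : (k : ℂ) ^ 2 = 1 := by exact_mod_cast hk
  have hkc0 : (k : ℂ) ≠ 0 := by exact_mod_cast hk0
  have hder : ∀ s : ℝ, HasDerivAt (fun s : ℝ => (k : ℂ) * (ζ s ^ (2⁻¹ : ℂ)))
      (I / ((k : ℂ) * (ζ s ^ (2⁻¹ : ℂ)))) s := by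
    intro s
    have h0 : HasDerivAt (fun x : ℂ => ((Y ^ 2 - 1 : ℝ) : ℂ) + (2 * x - 2 * Y) * I) (2 * I) (s : ℂ) := by
      have := ((((hasDerivAt_id (s : ℂ)).const_mul 2).sub_const (2 * (Y : ℂ))).mul_const I).const_add
        ((Y ^ 2 - 1 : ℝ) : ℂ)
      simpa using this
    have h1 := (h0.cpow_const (c := (2⁻¹ : ℂ)) (hslit s)).const_mul (k : ℂ)
    have h2 := h1.comp_ofReal
    convert h2 using 1
    change _ = (k : ℂ) * (2⁻¹ * ζ s ^ ((2⁻¹ : ℂ) - 1) * (2 * I))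
    rw [Complex.cpow_sub _ _ (hζ0 s), Complex.cpow_one]
    have e := hsq s
    have e0 := hS0 s
    have e1 := hζ0 s
    set S := ζ s ^ (2⁻¹ : ℂ)
    rw [← e]
    field_simp
    linear_combination (-1 : ℂ) * hkc
  refine ⟨by linarith, ?_, ?_, ?_, ?_, ?_, ?_⟩
  · exact fun s _ => (hder s).continuousAt.continuousWithinAt
  · have : ζ 0 = ((Y : ℂ) - I) ^ 2 := by
      simp only [hζ]; push_cast; linear_combination (-1 : ℂ) * Complex.I_sq
    change (k : ℂ) * ζ _ ^ (2⁻¹ : ℂ) = _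
    rw [this, Complex.sq_cpow_two_inv (by simp; linarith)]
  · have : ζ (2 * Y) = ((Y : ℂ) + I) ^ 2 := by
      simp only [hζ]; push_cast; linear_combination (-1 : ℂ) * Complex.I_sq
    change (k : ℂ) * ζ _ ^ (2⁻¹ : ℂ) = _
    rw [this, Complex.sq_cpow_two_inv (by simp; linarith)]
  · exact fun s _ => mul_ne_zero hkc0 (hS0 s)
  · intro s hs
    rw [mem_zone1, Complex.im_ofReal_mul]
    have e := hsq s
    set S := ζ s ^ (2⁻¹ : ℂ)
    have r1 : S.re ^ 2 - S.im ^ 2 = Y ^ 2 - 1 := by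
      rw [← hre s, ← e, pow_two S, Complex.mul_re]; ring
    have r2 : 2 * S.re * S.im = 2 * s - 2 * Y := by
      rw [← him s, ← e, pow_two S, Complex.mul_im]; ring
    have hs1 := hs.1
    have hs2 := hs.2
    rw [← sq_lt_one_iff_abs_lt_one, mul_pow, hk, one_mul]
    by_contra hcon
    push Not at hcon
    have h3 : (S.re * S.im) ^ 2 < Y ^ 2 := by
      have : S.re * S.im = s - Y := by linarith
      rw [this]; nlinarith
    have h4 : S.re ^ 2 * S.im ^ 2 < Y ^ 2 := by rw [← mul_pow]; exact h3
    nlinarith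
  · intro s hs
    rw [hf]; exact hder s

/-! ### The concrete system -/

lemma lin_sol {lam ctr : ℂ} {u : ℝ → ℂ} {s : ℝ} (hs : 0 ≤ s) (hu : ContinuousOn u (Icc 0 s))
    (du : ∀ r ∈ Ioo 0 s, HasDerivAt u (lam * (u r - ctr)) r) :
    (u s - ctr) * Complex.exp (-lam * s) = u 0 - ctr := by
  have key : (fun r : ℝ => (u r - ctr) * Complex.exp (-lam * r)) s =
      (fun r : ℝ => (u r - ctr) * Complex.exp (-lam * r)) 0 := by
    apply const_of_deriv_zero hs
    · apply (hu.sub continuousOn_const).mul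
      fun_prop
    · intro r hr
      have h1 : HasDerivAt (fun r : ℝ => Complex.exp (-lam * r)) (Complex.exp (-lam * r) * -lam) r := by
        have : HasDerivAt (fun x : ℂ => Complex.exp (-lam * x)) (Complex.exp (-lam * r) * -lam) (r : ℂ) := by
          have := ((hasDerivAt_id (r : ℂ)).const_mul (-lam)).cexp
          simpa using this
        exact this.comp_ofReal
      have h2 := ((du r hr).sub_const ctr).mul h1
      refine h2.congr_deriv ?_
      ring
  simpa using key

lemma no_stay_linear {f : Fin 3 → ℂ → ℂ} {w : ℝ → ℂ} (hw : Orb f w) {σ : Fin 3} {a b : ℝ} {ctr : ℂ}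
    (ha : a < 0) (hf : ∀ w, f σ w = ((a : ℂ) + b * I) * (w - ctr)) (hc : ctr ∉ zonesLines σ)
    (h : ∀ t, w t ∈ zonesLines σ) : False := by
  obtain ⟨T, hT, hper⟩ := hw.per
  have e := lin_sol (lam := (a : ℂ) + b * I) (ctr := ctr) hT.le hw.cont.continuousOn
    (fun r _ => by rw [← hf]; exact hw.der r σ (h r))
  have eT : w T = w 0 := by simpa using hper 0
  rw [eT] at e
  have hne : w 0 - ctr ≠ 0 := by
    intro h0
    rw [sub_eq_zero] at h0
    exact hc (h0 ▸ h 0)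
  have e1 : Complex.exp (-((a : ℂ) + b * I) * T) = 1 := by
    have : (w 0 - ctr) * Complex.exp (-((a : ℂ) + b * I) * T) = (w 0 - ctr) * 1 := by rw [e, mul_one]
    exact mul_left_cancel₀ hne this
  have e2 := congrArg (fun z : ℂ => ‖z‖) e1
  simp only [Complex.norm_exp, norm_one, Real.exp_eq_one_iff] at e2
  simp at e2
  rcases e2 with h | h <;> linarith

lemma no_stay_center {f : Fin 3 → ℂ → ℂ} {w : ℝ → ℂ} (hw : Orb f w)
    (hf : ∀ w, f 1 w = I / w) (h : ∀ t, w t ∈ zonesLines 1) : False := by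
  obtain ⟨T, hT, hper⟩ := hw.per
  have e := sq_const (σ := 1) hf hT.le hw.cont.continuousOn (fun r _ => hw.ne r)
    (fun r _ => hw.der r 1 (h r))
  have eT : w T = w 0 := by simpa using hper 0
  rw [eT] at e
  have := congrArg Complex.im e
  simp at this
  linarith

lemma exists_hit {f : Fin 3 → ℂ → ℂ} {w : ℝ → ℂ} (hw : Orb f w)
    (h0 : ¬ ∀ t, w t ∈ zonesLines 0) (h1 : ¬ ∀ t, w t ∈ zonesLines 1)
    (h2 : ¬ ∀ t, w t ∈ zonesLines 2) : ∃ t, (w t).im = 1 ∨ (w t).im = -1 := by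
  by_contra hcon
  push Not at hcon
  have hc : Continuous fun t => (w t).im := Complex.continuous_im.comp hw.cont
  have ivt : ∀ c : ℝ, (∀ t, (w t).im ≠ c) → (∀ t, (w t).im < c) ∨ (∀ t, c < (w t).im) := by
    intro c hne
    by_contra hh
    push Not at hh
    obtain ⟨⟨s, hs⟩, ⟨t, ht⟩⟩ := hh
    obtain ⟨r, hr⟩ := mem_range_of_exists_le_of_exists_ge hc ⟨t, ht⟩ ⟨s, hs⟩
    exact hne r hr
  rcases ivt 1 (fun t => (hcon t).1) with k | k
  · rcases ivt (-1) (fun t => (hcon t).2) with k' | k'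
    · exact h2 k'
    · exact h1 fun t => abs_lt.2 ⟨k' t, k t⟩
  · exact h0 k

lemma center_im (x y : ℝ) (hy : y ^ 2 = 1) : (I / ((x : ℂ) + y * I)).im = x / (x ^ 2 + 1) := by
  have : x ^ 2 + 1 ≠ 0 := by positivity
  rw [Complex.div_im]
  simp [Complex.normSq_apply]
  rw [show x * x + y * y = x ^ 2 + 1 by nlinarith]

lemma IsArc.ex {f : Fin 3 → ℂ → ℂ} {σ : Fin 3} {p q p' q' : ℂ} {L : ℝ} {E : ℝ → ℂ}
    (h : IsArc f σ p' q' L E) (hp : p = p') (hq : q = q') : ∃ L E, IsArc f σ p q L E := by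
  subst hp hq; exact ⟨L, E, h⟩

section
variable {f : Fin 3 → ℂ → ℂ} {a b c d x0 x1 : ℝ}

lemma f0_im (hf0 : ∀ w, f 0 w = ((a : ℂ) + (b : ℂ) * I) * (w - I + (x1 : ℂ))) (x : ℝ) :
    (f 0 ((x : ℂ) + I)).im = b * (x + x1) := by
  rw [hf0]; simp

lemma f2_im (hf2 : ∀ w, f 2 w = ((c : ℂ) + (d : ℂ) * I) * (w + I - (x0 : ℂ))) (x : ℝ) :
    (f 2 ((x : ℂ) - I)).im = d * (x - x0) := by
  rw [hf2]; simp

lemma f1_im_top (hf1 : ∀ w, f 1 w = I / w) (x : ℝ) :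
    (f 1 ((x : ℂ) + I)).im = x / (x ^ 2 + 1) := by
  rw [hf1]; simpa using center_im x 1 (by norm_num)

lemma f1_im_bot (hf1 : ∀ w, f 1 w = I / w) (x : ℝ) :
    (f 1 ((x : ℂ) - I)).im = x / (x ^ 2 + 1) := by
  rw [hf1]; simpa [sub_eq_add_neg] using center_im x (-1) (by norm_num)

lemma f1_cont (hf1 : ∀ w, f 1 w = I / w) {p : ℂ} (hp : p ≠ 0) : ContinuousAt (f 1) p := by
  have : f 1 = fun w => I / w := funext hf1
  rw [this]
  exact continuousAt_const.div continuousAt_id hp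

lemma arcU (hf0 : ∀ w, f 0 w = ((a : ℂ) + (b : ℂ) * I) * (w - I + (x1 : ℂ))) (hb : 0 < b)
    {x : ℝ} (hx : 0 < x + x1) :
    ∃ L E, IsArc f 0 ((x : ℂ) + I)
      (((-x1 - (x + x1) * Real.exp (a * Real.pi / b) : ℝ) : ℂ) + I) L E := by
  have := arc_spiral (f := f) (σ := 0) (a := a) (b := b) (r := x + x1) (ctr := I - x1) hb hx.ne'
    (fun w => by rw [hf0]; ring)
    (fun q hq => by
      have := (pos_iff_pos_of_mul_pos hq).1 hx
      simp at this
      exact this)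
    (fun q hq h0 => by
      subst h0
      simp at hq
      linarith)
  refine this.ex ?_ ?_
  · push_cast; ring
  · push_cast; ring

lemma arcD (hf2 : ∀ w, f 2 w = ((c : ℂ) + (d : ℂ) * I) * (w + I - (x0 : ℂ))) (hd : 0 < d)
    {x : ℝ} (hx : x - x0 < 0) :
    ∃ L E, IsArc f 2 ((x : ℂ) - I)
      (((x0 + (x0 - x) * Real.exp (c * Real.pi / d) : ℝ) : ℂ) - I) L E := by
  have := arc_spiral (f := f) (σ := 2) (a := c) (b := d) (r := x - x0) (ctr := x0 - I) hd hx.ne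
    (fun w => by rw [hf2]; ring)
    (fun q hq => by
      have := neg_of_mul_pos_right hq hx.le
      simp at this
      show q.im < -1
      linarith)
    (fun q hq h0 => by
      subst h0
      simp at hq
      linarith)
  refine this.ex ?_ ?_
  · push_cast; ring
  · push_cast; ring

lemma arcL (hf1 : ∀ w, f 1 w = I / w) {x : ℝ} (hx : x < -1) :
    ∃ L E, IsArc f 1 ((x : ℂ) + I) ((x : ℂ) - I) L E := by
  have := arc_center (f := f) (k := -1) (Y := -x) (by linarith) (by norm_num) hf1
  refine this.ex ?_ ?_
  · push_cast; ring
  · push_cast; ring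

lemma arcR (hf1 : ∀ w, f 1 w = I / w) {x : ℝ} (hx : 1 < x) :
    ∃ L E, IsArc f 1 ((x : ℂ) - I) ((x : ℂ) + I) L E := by
  have := arc_center (f := f) (k := 1) (Y := x) hx (by norm_num) hf1
  refine this.ex ?_ ?_
  · push_cast; ring
  · push_cast; ring

lemma top_ne (x : ℝ) : (x : ℂ) + I ≠ 0 := by
  intro h; have := congrArg Complex.im h; simp at this

lemma bot_ne (x : ℝ) : (x : ℂ) - I ≠ 0 := by
  intro h; have := congrArg Complex.im h; simp at this

lemma exists_cycle
    (hf0 : ∀ w, f 0 w = ((a : ℂ) + (b : ℂ) * I) * (w - I + (x1 : ℂ)))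
    (hf1 : ∀ w, f 1 w = I / w)
    (hf2 : ∀ w, f 2 w = ((c : ℂ) + (d : ℂ) * I) * (w + I - (x0 : ℂ)))
    (ha : a < 0) (hc : c < 0) (hb : 0 < b) (hd : 0 < d) (hx0 : 1 < x0) (hx1 : 1 < x1) :
    ∃ z : ℝ → ℂ, IsCrossingLimitCycle zonesLines f curvesLines z := by
  set α := Real.exp (a * Real.pi / b) with hα
  set β := Real.exp (c * Real.pi / d) with hβ
  have α0 : 0 < α := Real.exp_pos _
  have β0 : 0 < β := Real.exp_pos _
  have α1 : α < 1 := by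
    rw [hα, Real.exp_lt_one_iff]
    exact div_neg_of_neg_of_pos (mul_neg_of_neg_of_pos ha Real.pi_pos) hb
  have β1 : β < 1 := by
    rw [hβ, Real.exp_lt_one_iff]
    exact div_neg_of_neg_of_pos (mul_neg_of_neg_of_pos hc Real.pi_pos) hd
  have αβ0 : 0 < α * β := by positivity
  have αβ1 : α * β < 1 := by nlinarith
  have c0 : Continuous (f 0) := by rw [funext hf0]; fun_prop
  have c2 : Continuous (f 2) := by rw [funext hf2]; fun_prop
  -- signs
  have s1p : ∀ x : ℝ, 0 < x → 0 < x / (x ^ 2 + 1) := fun x hx => by positivity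
  have s1n : ∀ x : ℝ, x < 0 → x / (x ^ 2 + 1) < 0 := fun x hx =>
    div_neg_of_neg_of_pos hx (by positivity)
  -- deterministic passages
  have detU : ∀ x : ℝ, 0 < x → Det f ((x : ℂ) + I) (((-x1 - (x + x1) * α : ℝ) : ℂ) + I) := by
    intro x hx
    obtain ⟨L, E, h⟩ := arcU (a := a) hf0 hb (by linarith : 0 < x + x1)
    refine det_of_arc h (uniq_linear f 0 ((a : ℂ) + b * I) (I - x1) (fun w => by rw [hf0]; ring)) ?_
    exact enter_top_up (by simp) (f1_cont hf1 (top_ne x)) (by rw [f1_im_top hf1]; exact s1p x hx)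
  have detL : ∀ x : ℝ, x < -x1 → Det f ((x : ℂ) + I) ((x : ℂ) - I) := by
    intro x hx
    obtain ⟨L, E, h⟩ := arcL hf1 (by linarith : x < -1)
    refine det_of_arc h (uniq_center f 1 hf1) ?_
    exact enter_top_down (by simp) c0.continuousAt
      (by rw [f0_im hf0]; exact mul_neg_of_pos_of_neg hb (by linarith))
  have detD : ∀ x : ℝ, x < 0 → Det f ((x : ℂ) - I) (((x0 + (x0 - x) * β : ℝ) : ℂ) - I) := by
    intro x hx
    obtain ⟨L, E, h⟩ := arcD (c := c) hf2 hd (by linarith : x - x0 < 0)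
    refine det_of_arc h (uniq_linear f 2 ((c : ℂ) + d * I) (x0 - I) (fun w => by rw [hf2]; ring)) ?_
    exact enter_bot_down (by simp) (f1_cont hf1 (bot_ne x)) (by rw [f1_im_bot hf1]; exact s1n x hx)
  have detR : ∀ x : ℝ, x0 < x → Det f ((x : ℂ) - I) ((x : ℂ) + I) := by
    intro x hx
    obtain ⟨L, E, h⟩ := arcR hf1 (by linarith : 1 < x)
    refine det_of_arc h (uniq_center f 1 hf1) ?_
    exact enter_bot_up (by simp) c2.continuousAt
      (by rw [f2_im hf2]; exact mul_pos hd (by linarith))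
  have detDR : ∀ x : ℝ, x < 0 → Det f ((x : ℂ) - I) (((x0 + (x0 - x) * β : ℝ) : ℂ) + I) := by
    intro x hx
    have : 0 < (x0 - x) * β := mul_pos (by linarith) β0
    exact (detD x hx).trans (detR _ (by linarith))
  have uneg : ∀ x : ℝ, 0 < x → -x1 - (x + x1) * α < -x1 := by
    intro x hx
    have : 0 < (x + x1) * α := mul_pos (by linarith) α0
    linarith
  -- return map
  set xs : ℝ := (x0 + (x0 + x1 + x1 * α) * β) / (1 - α * β) with hxs
  have hden : 0 < 1 - α * β := by linarith
  have xsfix : xs = x0 + (x0 - (-x1 - (xs + x1) * α)) * β := by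
    have : xs * (1 - α * β) = x0 + (x0 + x1 + x1 * α) * β := by
      rw [hxs]; field_simp
    linarith
  have xspos : x0 < xs := by
    rw [hxs, lt_div_iff₀ hden]
    have : 0 < (x0 + x1 + x1 * α) * β := by positivity
    have : 0 < x0 * (α * β) := by positivity
    linarith
  have detG : ∀ x : ℝ, 0 < x → Det f ((x : ℂ) + I) (((xs + α * β * (x - xs) : ℝ) : ℂ) + I) := by
    intro x hx
    have hu := uneg x hx
    have := (detU x hx).trans ((detL _ hu).trans (detDR _ (by linarith)))
    have e : xs + α * β * (x - xs) = x0 + (x0 - (-x1 - (x + x1) * α)) * β := by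
      linear_combination xsfix
    rw [e]; exact this
  have detS : Det f ((xs : ℂ) + I) ((xs : ℂ) + I) := by
    have := detG xs (by linarith)
    simpa using this
  -- every orbit passes through the fixed point
  have through : ∀ w, Orb f w → ((xs : ℂ) + I) ∈ range w := by
    intro w hw
    have start : ∃ x : ℝ, 0 < x ∧ ((x : ℂ) + I) ∈ range w := by
      obtain ⟨t, ht⟩ := exists_hit hw
        (no_stay_linear (σ := 0) (b := b) hw (ctr := I - x1) ha (fun w => by rw [hf0]; ring)
          (by rw [mem_zone0]; simp))
        (no_stay_center hw hf1)
        (no_stay_linear (σ := 2) (b := d) hw (ctr := x0 - I) hc (fun w => by rw [hf2]; ring)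
          (by rw [mem_zone2]; simp))
      have fromBot : ∀ (x t : ℝ), x < 0 → w t = (x : ℂ) - I →
          ∃ x : ℝ, 0 < x ∧ ((x : ℂ) + I) ∈ range w := by
        intro x t hx hwt
        obtain ⟨L, -, F, k⟩ := detDR x hx
        have : 0 < (x0 - x) * β := mul_pos (by linarith) β0
        exact ⟨_, by linarith, ⟨_, (k w hw t hwt).2⟩⟩
      have sgn : ∀ x : ℝ, (0 < x / (x ^ 2 + 1) ↔ 0 < x) ∧ (x / (x ^ 2 + 1) < 0 ↔ x < 0) := by
        intro x
        have hh : 0 < x ^ 2 + 1 := by positivity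
        exact ⟨div_pos_iff_of_pos_right hh, by rw [div_lt_iff₀ hh, zero_mul]⟩
      rcases ht with ht | ht
      · have e : w t = ((w t).re : ℂ) + I := by
          apply Complex.ext <;> simp [ht]
        have sg := sign_top hw ht
        set x := (w t).re
        rw [e] at sg
        unfold CrossPt at sg
        rw [f0_im hf0, f1_im_top hf1, (sgn x).1, (sgn x).2] at sg
        rcases sg with ⟨-, h⟩ | ⟨h, -⟩
        · exact ⟨x, h, ⟨t, e⟩⟩
        · have hx : x < -x1 := by
            have := neg_of_mul_neg_right h hb.le
            linarith
          obtain ⟨L, -, F, k⟩ := detL x hx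
          exact fromBot x (t + L) (by linarith) (k w hw t e).2
      · have e : w t = ((w t).re : ℂ) - I := by
          apply Complex.ext <;> simp [ht]
        have sg := sign_bot hw ht
        set x := (w t).re
        rw [e] at sg
        unfold CrossPt at sg
        rw [f2_im hf2, f1_im_bot hf1, (sgn x).1, (sgn x).2] at sg
        rcases sg with ⟨-, h⟩ | ⟨h, -⟩
        · have hx : x0 < x := by
            have := pos_of_mul_pos_right h hd.le
            linarith
          obtain ⟨L, -, F, k⟩ := detR x hx
          exact ⟨x, by linarith, ⟨_, (k w hw t e).2⟩⟩
        · exact fromBot x t h e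
    obtain ⟨x, hx, hxw⟩ := start
    have it : ∀ n : ℕ, 0 < xs + (α * β) ^ n * (x - xs) ∧
        (((xs + (α * β) ^ n * (x - xs) : ℝ) : ℂ) + I) ∈ range w := by
      intro n
      have hpw : (α * β) ^ n ≤ 1 := pow_le_one₀ αβ0.le αβ1.le
      have hpw0 : 0 < (α * β) ^ n := by positivity
      refine ⟨?_, ?_⟩
      · have : 0 ≤ (1 - (α * β) ^ n) * xs := mul_nonneg (by linarith) (by linarith)
        have : 0 < (α * β) ^ n * x := by positivity
        linarith
      · induction n with
        | zero => simpa using hxw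
        | succ n ih =>
          have hpw : (α * β) ^ n ≤ 1 := pow_le_one₀ αβ0.le αβ1.le
          have hpw0 : 0 < (α * β) ^ n := by positivity
          obtain ⟨t, ht⟩ := ih hpw hpw0
          have hpos : 0 < xs + (α * β) ^ n * (x - xs) := by
            have : 0 ≤ (1 - (α * β) ^ n) * xs := mul_nonneg (by linarith) (by linarith)
            have : 0 < (α * β) ^ n * x := by positivity
            linarith
          obtain ⟨L, -, F, k⟩ := detG _ hpos
          refine ⟨t + L, ?_⟩
          rw [(k w hw t ht).2]
          congr 2; ring
    obtain ⟨T, hT, hper⟩ := hw.per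
    have hcl : IsClosed (range w) := (hper.compact_of_continuous hT.ne' hw.cont).isClosed
    have hl : Tendsto (fun n : ℕ => ((xs + (α * β) ^ n * (x - xs) : ℝ) : ℂ) + I) atTop
        (𝓝 ((xs : ℂ) + I)) := by
      have h1 : Tendsto (fun n : ℕ => xs + (α * β) ^ n * (x - xs)) atTop (𝓝 (xs + 0 * (x - xs))) :=
        ((tendsto_pow_atTop_nhds_zero_of_lt_one αβ0.le αβ1).mul_const _).const_add _
      rw [zero_mul, add_zero] at h1
      exact ((Complex.continuous_ofReal.tendsto xs).comp h1).add_const I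
    exact hcl.mem_of_tendsto hl (Eventually.of_forall fun n => (it n).2)
  -- construction
  have hu := uneg xs (by linarith)
  set X : ℝ := -x1 - (xs + x1) * α with hX
  obtain ⟨L1, E1, A1⟩ := arcU (a := a) hf0 hb (by linarith : 0 < xs + x1)
  obtain ⟨L2, E2, A2⟩ := arcL hf1 (by linarith : X < -1)
  obtain ⟨L3, E3, A3⟩ := arcD (c := c) hf2 hd (by linarith : X - x0 < 0)
  obtain ⟨L4, E4, A4⟩ := arcR hf1 (by linarith : 1 < xs)
  rw [← hα, ← hX] at A1
  rw [← hβ, ← xsfix] at A3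
  have P := ((A1.isPath.trans A2.isPath (by decide) (by simp) (by
      right; rw [f0_im hf0, f1_im_top hf1]
      exact ⟨mul_neg_of_pos_of_neg hb (by linarith), s1n _ (by linarith)⟩)).trans A3.isPath
      (by decide) (by simp) (by
      right; rw [f2_im hf2, f1_im_bot hf1]
      exact ⟨s1n _ (by linarith), mul_neg_of_pos_of_neg hd (by linarith)⟩)).trans A4.isPath
      (by decide) (by simp) (by
      left; rw [f2_im hf2, f1_im_bot hf1]
      exact ⟨mul_pos hd (by linarith), s1p _ (by linarith)⟩)
  obtain ⟨z, hz, hz0, -⟩ := P.close (by decide) (by simp) (by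
      left; rw [f0_im hf0, f1_im_top hf1]
      exact ⟨s1p _ (by linarith), mul_pos hb (by linarith)⟩)
  have oz := orb_of f z hz hz0
  refine ⟨z, hz, {0}ᶜ, isOpen_compl_singleton, ?_, ?_⟩
  · rintro _ ⟨t, rfl⟩; exact hz0 t
  · intro w hw hwU
    have ow := orb_of f w hw (fun t => hwU ⟨t, rfl⟩)
    exact det_range detS ow oz (through w ow) (through z oz)

end

/-- **Proposition.** If `a, b, c, d, x₀, x₁` are nonzero reals with `a, c < 0`, `b, d > 0`,
`x₀, x₁ > 1`, then the system `ż = (a+ib)(z - i + x₁)` in `Σ₊`, `ż = i/z` in `Σ_c`,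
`ż = (c+id)(z + i - x₀)` in `Σ₋` has a crossing limit cycle. -/
theorem limit_cycle_pole_center (a b c d x0 x1 : ℝ)
    (ha0 : a ≠ 0) (hb0 : b ≠ 0) (hc0 : c ≠ 0) (hd0 : d ≠ 0) (hx00 : x0 ≠ 0) (hx10 : x1 ≠ 0)
    (ha : a < 0) (hc : c < 0) (hb : 0 < b) (hd : 0 < d) (hx0 : 1 < x0) (hx1 : 1 < x1) :
    ∃ z : ℝ → ℂ, IsCrossingLimitCycle zonesLines
      ![fun w => ((a : ℂ) + (b : ℂ) * Complex.I) * (w - Complex.I + (x1 : ℂ)),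
        fun w => Complex.I / w,
        fun w => ((c : ℂ) + (d : ℂ) * Complex.I) * (w + Complex.I - (x0 : ℂ))]
      curvesLines z := by
  exact exists_cycle (fun _ => rfl) (fun _ => rfl) (fun _ => rfl) ha hc hb hd hx0 hx1
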